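/- arXiv:2402.06778 — 2 statements merged into one kernel-verified Lean document; each statement's English description precedes it below -/
import Mathlib

section
/- Disagreement bound for the primal iterate (Lemma 2, inequality for x̃): under the DQN recurrence, for every k ≥ 0, ‖x̃^{(k+1)}‖₂ ≤ λ ‖x̃^{(k)}‖₂ + λ r_α ‖(α^{(k)} z^{(k)})‾‖₂ + λ² α_max (1 + r_α) q (‖ṽ^{(k)}‖₂ + ‖ḡ^{(k)}‖₂), where (α^{(k)} z^{(k)})‾ is the row-wise mean of α^{(k)} z^{(k)} and ḡ^{(k)} is the row-wise mean of g(x^{(k)}). -/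
open Matrix Filter Topology

/-- Spectral norm (largest singular value) of a real matrix. -/
noncomputable def specNorm {m n : ℕ} (A : Matrix (Fin m) (Fin n) ℝ) : ℝ :=
  ‖LinearMap.toContinuousLinearMap (Matrix.toEuclideanLin A)‖

/-- Row-wise mean `(1/N) 11ᵀ A` of a matrix. -/
noncomputable def rowMean {N n : ℕ} (A : Matrix (Fin N) (Fin n) ℝ) : Matrix (Fin N) (Fin n) ℝ :=
  ((1 : ℝ) / N) • (Matrix.of (fun _ _ => (1 : ℝ)) * A)

/-- The stacked-gradient matrix `g(x)` whose `i`-th row is `∇f_i(x_i)ᵀ`. -/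
noncomputable def gradMat {N n : ℕ} (f : Fin N → EuclideanSpace ℝ (Fin n) → ℝ)
    (x : Matrix (Fin N) (Fin n) ℝ) : Matrix (Fin N) (Fin n) ℝ :=
  Matrix.of fun i j =>
    WithLp.equiv 2 (Fin n → ℝ) (gradient (f i) ((WithLp.equiv 2 (Fin n → ℝ)).symm (x i))) j

open scoped Matrix.Norms.L2Operator

theorem specNorm_eq_l2_opNorm {m n : ℕ} (A : Matrix (Fin m) (Fin n) ℝ) : specNorm A = ‖A‖ :=
  (Matrix.l2_opNorm_def A).symm

/-- The averaging matrix `(1/N) 11ᵀ`. -/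
noncomputable def avgMat (N : ℕ) : Matrix (Fin N) (Fin N) ℝ :=
  ((1 : ℝ) / N) • Matrix.of fun _ _ => (1 : ℝ)

theorem rowMean_eq_avgMat_mul {N n : ℕ} (A : Matrix (Fin N) (Fin n) ℝ) :
    rowMean A = avgMat N * A :=
  (Matrix.smul_mul _ _ _).symm

theorem avgMat_mul_diagonal_mul_avgMat {N : ℕ} (a : Fin N → ℝ) :
    avgMat N * Matrix.diagonal a * avgMat N = ((1 / (N : ℝ)) * ∑ j, a j) • avgMat N := by
  ext i j
  rw [Matrix.mul_apply]
  simp only [avgMat, Matrix.mul_diagonal, Matrix.smul_apply, Matrix.of_apply,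
    smul_eq_mul, mul_one]
  rw [← Finset.sum_mul, ← Finset.mul_sum]

theorem avgMat_mul_self {N : ℕ} (hN : 0 < N) : avgMat N * avgMat N = avgMat N := by
  have hN₀ : (N : ℝ) ≠ 0 := by positivity
  simpa [hN₀] using avgMat_mul_diagonal_mul_avgMat (N := N) (fun _ => 1)

theorem avgMat_isHermitian (N : ℕ) : (avgMat N).IsHermitian := by
  ext i j
  simp [avgMat]

theorem mul_avgMat_of_mulVec_one {N : ℕ} {W : Matrix (Fin N) (Fin N) ℝ}
    (h : W *ᵥ (fun _ => (1 : ℝ)) = fun _ => 1) : W * avgMat N = avgMat N := by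
  ext i j
  have hi : ∑ l, W i l = 1 := by simpa [Matrix.mulVec, dotProduct] using congrFun h i
  simp [avgMat, Matrix.mul_apply, hi, ← Finset.sum_mul]

theorem avgMat_mul_of_one_vecMul {N : ℕ} {W : Matrix (Fin N) (Fin N) ℝ}
    (h : (fun _ => (1 : ℝ)) ᵥ* W = fun _ => 1) : avgMat N * W = avgMat N := by
  ext i j
  have hj : ∑ l, W l j = 1 := by simpa [Matrix.vecMul, dotProduct] using congrFun h j
  simp [avgMat, Matrix.mul_apply, hj, ← Finset.mul_sum]

/-- An orthogonal projection has spectral norm at most one. -/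
theorem l2_opNorm_le_one_of_isHermitian_of_mul_self {N : ℕ} {P : Matrix (Fin N) (Fin N) ℝ}
    (hP : P.IsHermitian) (hPP : P * P = P) : ‖P‖ ≤ 1 := by
  have h := Matrix.l2_opNorm_conjTranspose_mul_self P
  rw [hP.eq, hPP] at h
  nlinarith [norm_nonneg P]

theorem l2_opNorm_le_sqrt_sum_sq {m n : ℕ} (A : Matrix (Fin m) (Fin n) ℝ) :
    ‖A‖ ≤ √(∑ i, ∑ j, A i j ^ 2) := by
  rw [Matrix.l2_opNorm_def]
  refine ContinuousLinearMap.opNorm_le_bound _ (Real.sqrt_nonneg _) fun u => ?_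
  rw [EuclideanSpace.norm_eq, EuclideanSpace.norm_eq, ← Real.sqrt_mul (by positivity),
    Finset.sum_mul]
  refine Real.sqrt_le_sqrt (Finset.sum_le_sum fun i _ => ?_)
  simpa [Matrix.mulVec, dotProduct] using Finset.sum_mul_sq_le_sq_mul_sq Finset.univ (A i) u

theorem sum_sq_le_card_mul_l2_opNorm_sq {m n : ℕ} (A : Matrix (Fin m) (Fin n) ℝ) :
    ∑ i, ∑ j, A i j ^ 2 ≤ n * ‖A‖ ^ 2 := by
  rw [Finset.sum_comm]
  have hcol : ∀ j, ∑ i, A i j ^ 2 ≤ ‖A‖ ^ 2 := fun j => by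
    have h := Matrix.l2_opNorm_mulVec A (EuclideanSpace.single j (1 : ℝ))
    rw [PiLp.norm_single, norm_one, mul_one, EuclideanSpace.norm_eq] at h
    have hsq := (Real.sqrt_le_left (norm_nonneg A)).1 h
    simpa using hsq
  simpa using Finset.sum_le_sum fun j (_ : j ∈ Finset.univ) => hcol j

theorem sum_sq_le_min_mul_l2_opNorm_sq {m n : ℕ} (A : Matrix (Fin m) (Fin n) ℝ) :
    ∑ i, ∑ j, A i j ^ 2 ≤ min (n : ℝ) (m : ℝ) * ‖A‖ ^ 2 := by
  rw [min_mul_of_nonneg _ _ (sq_nonneg _)]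
  refine le_min (sum_sq_le_card_mul_l2_opNorm_sq A) ?_
  have h := sum_sq_le_card_mul_l2_opNorm_sq Aᴴ
  rw [Matrix.l2_opNorm_conjTranspose, Finset.sum_comm] at h
  simpa using h

theorem sum_mulVec_sq_le {m n : ℕ} {c : ℝ} {C : Matrix (Fin m) (Fin n) ℝ} (hC : ‖C‖ ≤ c)
    (u : Fin n → ℝ) : ∑ i, (C *ᵥ u) i ^ 2 ≤ c ^ 2 * ∑ j, u j ^ 2 := by
  have h := (Matrix.l2_opNorm_mulVec C (WithLp.toLp 2 u)).trans
    (mul_le_mul_of_nonneg_right hC (norm_nonneg _))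
  have hsq := pow_le_pow_left₀ (norm_nonneg _) h 2
  rw [mul_pow, EuclideanSpace.norm_sq_eq, EuclideanSpace.norm_sq_eq] at hsq
  simpa using hsq

/-- Applying to each row a matrix of spectral norm at most `c` enlarges the spectral norm by a
factor of at most `c * √(min n m)`. -/
theorem l2_opNorm_le_of_rows_eq_neg_mulVec {m n : ℕ} {c : ℝ} (hc : 0 ≤ c)
    {C : Fin m → Matrix (Fin n) (Fin n) ℝ} (hC : ∀ i, ‖C i‖ ≤ c)
    {d v : Matrix (Fin m) (Fin n) ℝ} (hd : ∀ i, d i = -(C i *ᵥ v i)) :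
    ‖d‖ ≤ c * √(min (n : ℝ) (m : ℝ)) * ‖v‖ := by
  refine (l2_opNorm_le_sqrt_sum_sq d).trans (Real.sqrt_le_iff.2 ⟨by positivity, ?_⟩)
  calc ∑ i, ∑ j, d i j ^ 2 ≤ ∑ i, c ^ 2 * ∑ j, v i j ^ 2 :=
        Finset.sum_le_sum fun i _ => by simpa [hd i] using sum_mulVec_sq_le (hC i) (v i)
    _ = c ^ 2 * ∑ i, ∑ j, v i j ^ 2 := by rw [Finset.mul_sum]
    _ ≤ c ^ 2 * (min (n : ℝ) (m : ℝ) * ‖v‖ ^ 2) :=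
        mul_le_mul_of_nonneg_left (sum_sq_le_min_mul_l2_opNorm_sq v) (sq_nonneg c)
    _ = (c * √(min (n : ℝ) (m : ℝ)) * ‖v‖) ^ 2 := by
        rw [mul_pow, mul_pow, Real.sq_sqrt (by positivity), mul_assoc]

theorem l2_opNorm_mul_le_of_le {l m n : ℕ} {A : Matrix (Fin l) (Fin m) ℝ}
    {B : Matrix (Fin m) (Fin n) ℝ} {a b : ℝ} (hA : ‖A‖ ≤ a) (hB : ‖B‖ ≤ b) :
    ‖A * B‖ ≤ a * b :=
  (Matrix.l2_opNorm_mul A B).trans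
    (mul_le_mul hA hB (norm_nonneg _) ((norm_nonneg _).trans hA))

/-- The consensus error of `D z`, for a diagonal matrix `D` with mean entry `μ`, is controlled by
the mean of `D z` and the consensus error of `z`. -/
theorem l2_opNorm_consensusError_diagonal_mul_le {N n : ℕ} (hN : 0 < N) {a : Fin N → ℝ}
    {A r : ℝ} (hμ : 0 < (1 / (N : ℝ)) * ∑ j, a j) (hA : ‖Matrix.diagonal a‖ ≤ A)
    (hr : A * (1 / ((1 / (N : ℝ)) * ∑ j, a j)) ≤ r) (z : Matrix (Fin N) (Fin n) ℝ) :
    ‖(1 - avgMat N) * (Matrix.diagonal a * z)‖ ≤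
      r * ‖avgMat N * (Matrix.diagonal a * z)‖ + A * (1 + r) * ‖(1 - avgMat N) * z‖ := by
  set J := avgMat N
  set D := Matrix.diagonal a
  set μ := (1 / (N : ℝ)) * ∑ j, a j
  have hJJ : J * J = J := avgMat_mul_self hN
  have hJ : ‖J‖ ≤ 1 := l2_opNorm_le_one_of_isHermitian_of_mul_self (avgMat_isHermitian N) hJJ
  have hP : ‖1 - J‖ ≤ 1 := by
    refine l2_opNorm_le_one_of_isHermitian_of_mul_self
      (Matrix.isHermitian_one.sub (avgMat_isHermitian N)) ?_
    simp [Matrix.mul_sub, Matrix.sub_mul, hJJ]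
  have hA0 : 0 ≤ A := (norm_nonneg _).trans hA
  have hDe : ‖D * ((1 - J) * z)‖ ≤ A * ‖(1 - J) * z‖ := l2_opNorm_mul_le_of_le hA le_rfl
  have hmean : J * z = (1 / μ) • (J * (D * z) - J * (D * ((1 - J) * z))) := by
    have h : J * D * J * z = μ • (J * z) := by
      rw [avgMat_mul_diagonal_mul_avgMat, Matrix.smul_mul]
    rw [eq_comm, one_div, inv_smul_eq_iff₀ hμ.ne', ← h]
    simp only [Matrix.sub_mul, Matrix.mul_sub, Matrix.one_mul, Matrix.mul_assoc]
    abel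
  have hJz : ‖J * z‖ ≤ (1 / μ) * (‖J * (D * z)‖ + A * ‖(1 - J) * z‖) := by
    rw [hmean, norm_smul, Real.norm_of_nonneg (by positivity)]
    refine mul_le_mul_of_nonneg_left ((norm_sub_le _ _).trans ?_) (by positivity)
    have := l2_opNorm_mul_le_of_le hJ hDe
    linarith
  have hsplit : (1 - J) * (D * z) =
      (1 - J) * (D * ((1 - J) * z)) + (1 - J) * (D * (J * z)) := by
    rw [← Matrix.mul_add, ← Matrix.mul_add, ← Matrix.add_mul, sub_add_cancel, Matrix.one_mul]
  have h₁ := l2_opNorm_mul_le_of_le hP hDe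
  have h₂ := l2_opNorm_mul_le_of_le hP (l2_opNorm_mul_le_of_le hA hJz)
  have h₃ := mul_le_mul_of_nonneg_right hr
    (by positivity : 0 ≤ ‖J * (D * z)‖ + A * ‖(1 - J) * z‖)
  rw [hsplit]
  refine (norm_add_le _ _).trans ?_
  linarith

/-- Gradient tracking: the mean of the trackers equals the mean of the tracked quantities. -/
theorem avgMat_mul_tracker_eq {N n : ℕ} {W : Matrix (Fin N) (Fin N) ℝ}
    (hJW : avgMat N * W = avgMat N) {v g : ℕ → Matrix (Fin N) (Fin n) ℝ} (hv0 : v 0 = g 0)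
    (hv : ∀ k, v (k + 1) = W * (v k + g (k + 1) - g k)) (k : ℕ) :
    avgMat N * v k = avgMat N * g k := by
  induction k with
  | zero => rw [hv0]
  | succ k ih =>
    rw [hv, ← Matrix.mul_assoc, hJW, Matrix.mul_sub, Matrix.mul_add, ih, add_sub_cancel_left]

theorem dqn_primal_disagreement_bound
    {N n : ℕ} (hN : 0 < N) (hn : 0 < n)
    (f : Fin N → EuclideanSpace ℝ (Fin n) → ℝ)
    (hdiff : ∀ i, Differentiable ℝ (f i))
    (L : ℝ)
    (hL : ∀ i (u w : EuclideanSpace ℝ (Fin n)),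
      ‖gradient (f i) u - gradient (f i) w‖ ≤ L * ‖u - w‖)
    (W : Matrix (Fin N) (Fin N) ℝ)
    (hW1 : W *ᵥ (fun _ => (1 : ℝ)) = fun _ => 1)
    (h1W : (fun _ => (1 : ℝ)) ᵥ* W = fun _ => 1)
    (lam : ℝ)
    (hlam : lam = specNorm (W - ((1 : ℝ) / N) • Matrix.of (fun _ _ => (1 : ℝ))))
    (γ : ℝ) (hγ : 0 < γ)
    (C : ℕ → Fin N → Matrix (Fin n) (Fin n) ℝ)
    (hCsymm : ∀ k i, (C k i).IsSymm)
    (hCpos : ∀ k i, (C k i).PosDef)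
    (hCnorm : ∀ k i, specNorm (C k i) ≤ γ)
    (α : ℕ → Fin N → ℝ) (hα : ∀ k i, 0 < α k i)
    (x v z d : ℕ → Matrix (Fin N) (Fin n) ℝ)
    (hx : ∀ k, x (k + 1) = W * (x k + Matrix.diagonal (α k) * z k))
    (hv0 : v 0 = gradMat f (x 0))
    (hv : ∀ k, v (k + 1) = W * (v k + gradMat f (x (k + 1)) - gradMat f (x k)))
    (hd : ∀ k i, d k i = -(C k i *ᵥ v k i))
    (hz0 : z 0 = W * d 0)
    (hz : ∀ k, z (k + 1) = W * d (k + 1))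
    (q : ℝ) (hq : q = γ * Real.sqrt (min (n : ℝ) (N : ℝ)))
    (αmax : ℝ)
    (hαbdd : BddAbove (Set.range fun k => specNorm (Matrix.diagonal (α k))))
    (hαmax : αmax = ⨆ k, specNorm (Matrix.diagonal (α k)))
    (rα : ℝ)
    (hrbdd : BddAbove (Set.range fun k => 1 / ((1 / (N : ℝ)) * ∑ j, α k j)))
    (hrα : rα = αmax * ⨆ k, 1 / ((1 / (N : ℝ)) * ∑ j, α k j))
    :
    ∀ k, specNorm (x (k + 1) - rowMean (x (k + 1))) ≤
      lam * specNorm (x k - rowMean (x k)) +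
      lam * rα * specNorm (rowMean (Matrix.diagonal (α k) * z k)) +
      lam ^ 2 * αmax * (1 + rα) * q *
        (specNorm (v k - rowMean (v k)) + specNorm (rowMean (gradMat f (x k)))) := by
  intro k
  have hJW : avgMat N * W = avgMat N := avgMat_mul_of_one_vecMul h1W
  have hWJ : W * avgMat N = avgMat N := mul_avgMat_of_mulVec_one hW1
  have hJJ : avgMat N * avgMat N = avgMat N := avgMat_mul_self hN
  have hzk : z k = W * d k := by
    cases k with
    | zero => exact hz0
    | succ k => exact hz k
  have htrack : avgMat N * v k = avgMat N * gradMat f (x k) :=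
    avgMat_mul_tracker_eq (g := fun k => gradMat f (x k)) hJW hv0 hv k
  have hsub : ∀ A : Matrix (Fin N) (Fin n) ℝ, A - avgMat N * A = (1 - avgMat N) * A := fun A => by
    rw [Matrix.sub_mul, Matrix.one_mul]
  change lam = specNorm (W - avgMat N) at hlam
  simp only [rowMean_eq_avgMat_mul, specNorm_eq_l2_opNorm, ← htrack, hsub]
    at hlam hCnorm hαbdd hαmax ⊢
  have hlam0 : 0 ≤ lam := hlam ▸ norm_nonneg _
  have hA : ‖Matrix.diagonal (α k)‖ ≤ αmax := hαmax ▸ le_ciSup hαbdd k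
  have hA0 : 0 ≤ αmax := (norm_nonneg _).trans hA
  have hr : αmax * (1 / ((1 / (N : ℝ)) * ∑ j, α k j)) ≤ rα :=
    hrα ▸ mul_le_mul_of_nonneg_left (le_ciSup hrbdd k) hA0
  have hμ : 0 < (1 / (N : ℝ)) * ∑ j, α k j :=
    mul_pos (by positivity) (Finset.sum_pos (fun j _ => hα k j) ⟨⟨0, hN⟩, Finset.mem_univ _⟩)
  have hr0 : 0 ≤ rα := le_trans (by positivity) hr
  have hq0 : 0 ≤ q := hq ▸ by positivity
  have hvk : ‖v k‖ ≤ ‖(1 - avgMat N) * v k‖ + ‖avgMat N * v k‖ := by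
    have h := norm_add_le ((1 - avgMat N) * v k) (avgMat N * v k)
    rwa [← Matrix.add_mul, sub_add_cancel, Matrix.one_mul] at h
  have hdk : ‖d k‖ ≤ q * (‖(1 - avgMat N) * v k‖ + ‖avgMat N * v k‖) :=
    (hq ▸ l2_opNorm_le_of_rows_eq_neg_mulVec hγ.le (hCnorm k) (hd k)).trans
      (mul_le_mul_of_nonneg_left hvk hq0)
  have hze : ‖(1 - avgMat N) * z k‖ ≤
      lam * (q * (‖(1 - avgMat N) * v k‖ + ‖avgMat N * v k‖)) := by
    rw [hzk, ← Matrix.mul_assoc, Matrix.sub_mul, Matrix.one_mul, hJW]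
    exact l2_opNorm_mul_le_of_le hlam.ge hdk
  have hDz := (l2_opNorm_consensusError_diagonal_mul_le hN hμ hA hr (z k)).trans
    (add_le_add_right (mul_le_mul_of_nonneg_left hze (by positivity)) _)
  have hstep : (1 - avgMat N) * x (k + 1) = (W - avgMat N) *
      ((1 - avgMat N) * x k + (1 - avgMat N) * (Matrix.diagonal (α k) * z k)) := by
    rw [hx, ← Matrix.mul_add, ← Matrix.mul_assoc, ← Matrix.mul_assoc]
    simp [Matrix.sub_mul, Matrix.mul_sub, hJW, hWJ, hJJ]
  rw [hstep]
  refine (l2_opNorm_mul_le_of_le hlam.ge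
    ((norm_add_le _ _).trans (add_le_add_right hDz _))).trans (le_of_eq ?_)
  ring
end

section
/- Spectral-norm bound for the stacked quasi-Newton step: let v ∈ ℝ^{N×n} and let d ∈ ℝ^{N×n} be the matrix whose i-th row is −C_i v_i, where v_i is the i-th row of v and each C_i ∈ ℝ^{n×n} is symmetric positive semidefinite with spectral norm at most γ > 0. Then ‖d‖₂ ≤ γ √(min{n,N}) ‖v‖₂, where ‖·‖₂ denotes the spectral norm of a matrix. -/
open Matrix

theorem specNorm_nonneg {m n : ℕ} (A : Matrix (Fin m) (Fin n) ℝ) : 0 ≤ specNorm A :=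
  norm_nonneg _

theorem sum_sq_mulVec_le {m n : ℕ} (A : Matrix (Fin m) (Fin n) ℝ) (x : Fin n → ℝ) :
    ∑ i, (A *ᵥ x) i ^ 2 ≤ specNorm A ^ 2 * ∑ j, x j ^ 2 := by
  have h := (LinearMap.toContinuousLinearMap (Matrix.toEuclideanLin A)).le_opNorm
    (WithLp.toLp 2 x)
  have h2 := pow_le_pow_left₀ (norm_nonneg _) h 2
  rw [mul_pow, EuclideanSpace.real_norm_sq_eq, EuclideanSpace.real_norm_sq_eq] at h2
  simpa [specNorm] using h2

theorem specNorm_sq_le_sum_sq {m n : ℕ} (A : Matrix (Fin m) (Fin n) ℝ) :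
    specNorm A ^ 2 ≤ ∑ i, ∑ j, A i j ^ 2 := by
  have hF : 0 ≤ ∑ i, ∑ j, A i j ^ 2 := by positivity
  rw [← Real.le_sqrt (specNorm_nonneg A) hF]
  refine ContinuousLinearMap.opNorm_le_bound _ (Real.sqrt_nonneg _) fun x => ?_
  refine le_of_pow_le_pow_left₀ two_ne_zero (by positivity) ?_
  rw [mul_pow, Real.sq_sqrt hF, EuclideanSpace.real_norm_sq_eq, EuclideanSpace.real_norm_sq_eq,
    Finset.sum_mul]
  refine Finset.sum_le_sum fun i _ => ?_
  simpa [Matrix.mulVec, dotProduct] using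
    Finset.sum_mul_sq_le_sq_mul_sq Finset.univ (A i) x.ofLp

theorem specNorm_transpose {m n : ℕ} (A : Matrix (Fin m) (Fin n) ℝ) :
    specNorm Aᵀ = specNorm A := by
  have h := Matrix.l2_opNorm_conjTranspose A
  rwa [Matrix.conjTranspose_eq_transpose_of_trivial] at h

theorem sum_sq_le_card_cols_mul {m n : ℕ} (A : Matrix (Fin m) (Fin n) ℝ) :
    ∑ i, ∑ j, A i j ^ 2 ≤ n * specNorm A ^ 2 := by
  rw [Finset.sum_comm]
  have h : ∀ j ∈ Finset.univ, ∑ i, A i j ^ 2 ≤ specNorm A ^ 2 := fun j _ => by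
    simpa [Pi.single_apply] using sum_sq_mulVec_le A (Pi.single j 1)
  simpa using Finset.sum_le_sum h

theorem sum_sq_le_min_mul {m n : ℕ} (A : Matrix (Fin m) (Fin n) ℝ) :
    ∑ i, ∑ j, A i j ^ 2 ≤ min (n : ℝ) m * specNorm A ^ 2 := by
  rw [min_mul_of_nonneg _ _ (sq_nonneg _)]
  refine le_min (sum_sq_le_card_cols_mul A) ?_
  rw [Finset.sum_comm, ← specNorm_transpose]
  exact sum_sq_le_card_cols_mul Aᵀ

theorem stacked_quasi_newton_step_bound
    {N n : ℕ} (hN : 0 < N) (hn : 0 < n)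
    (γ : ℝ) (hγ : 0 < γ)
    (C : Fin N → Matrix (Fin n) (Fin n) ℝ)
    (hCsymm : ∀ i, (C i).IsSymm)
    (hCpsd : ∀ i, (C i).PosSemidef)
    (hCnorm : ∀ i, specNorm (C i) ≤ γ)
    (v d : Matrix (Fin N) (Fin n) ℝ)
    (hd : ∀ i, d i = -(C i *ᵥ v i)) :
    specNorm d ≤ γ * Real.sqrt (min (n : ℝ) (N : ℝ)) * specNorm v := by
  have hv := specNorm_nonneg v
  have hrow : ∀ i, ∑ j, d i j ^ 2 ≤ γ ^ 2 * ∑ j, v i j ^ 2 := fun i => by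
    have h := sum_sq_mulVec_le (C i) (v i)
    have hsq := pow_le_pow_left₀ (specNorm_nonneg (C i)) (hCnorm i) 2
    simp only [hd i, Pi.neg_apply, neg_sq]
    exact h.trans (by gcongr)
  refine le_of_pow_le_pow_left₀ two_ne_zero (by positivity) ?_
  calc specNorm d ^ 2 ≤ ∑ i, ∑ j, d i j ^ 2 := specNorm_sq_le_sum_sq d
    _ ≤ γ ^ 2 * ∑ i, ∑ j, v i j ^ 2 := by
      rw [Finset.mul_sum]
      exact Finset.sum_le_sum fun i _ => hrow i
    _ ≤ γ ^ 2 * (min (n : ℝ) N * specNorm v ^ 2) := by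
      gcongr
      exact sum_sq_le_min_mul v
    _ = (γ * Real.sqrt (min (n : ℝ) N) * specNorm v) ^ 2 := by
      rw [mul_pow, mul_pow, Real.sq_sqrt (by positivity), mul_assoc]
end
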